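/- Every (6,3)-configuration is isomorphic to one of exactly two configurations: the one described by the three 4-cycles (a,b,c,d), (a,e,c,f), (b,e,f,d), or the one described by the three 4-cycles (a,b,c,d), (a,e,c,f), (b,e,d,f), where a,b,c,d,e,f are six distinct vertices. -/

import Mathlib

open Finset

/-- The edge set of the 4-cycle `(a, b, c, d)`: edges {a,b}, {b,c}, {c,d}, {d,a}. -/
def cycEdges {V : Type*} [DecidableEq V] (a b c d : V) : Finset (Sym2 V) :=
  {s(a, b), s(b, c), s(c, d), s(d, a)}

/-- `E` is the edge set of a 4-cycle on four distinct vertices. -/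
def IsFourCycle {V : Type*} [DecidableEq V] (E : Finset (Sym2 V)) : Prop :=
  ∃ a b c d : V, ([a, b, c, d] : List V).Nodup ∧ E = cycEdges a b c d

/-- The set of vertices covered by a set of edges. -/
def edgeVerts {V : Type*} [DecidableEq V] (E : Finset (Sym2 V)) : Finset V :=
  E.sup (Sym2.lift ⟨fun x y => ({x, y} : Finset V), fun x y => Finset.pair_comm x y⟩)

/-- A `(k, l)`-configuration: a set of `l` pairwise edge-disjoint 4-cycles whose
union contains exactly `k` vertices. -/
def IsConfiguration {V : Type*} [DecidableEq V] (k l : ℕ)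
    (D : Finset (Finset (Sym2 V))) : Prop :=
  D.card = l ∧ (∀ E ∈ D, IsFourCycle E) ∧
    (∀ E ∈ D, ∀ F ∈ D, E ≠ F → Disjoint E F) ∧
    (D.sup edgeVerts).card = k

/-- `C` is a 4-cycle system: a collection of 4-cycles whose edge sets partition
the edge set of the complete graph on `V`. -/
def IsFourCycleSystem {V : Type*} [DecidableEq V] (C : Finset (Finset (Sym2 V))) : Prop :=
  (∀ E ∈ C, IsFourCycle E) ∧ ∀ e : Sym2 V, ¬ e.IsDiag → ∃! E, E ∈ C ∧ e ∈ E

/-- `C` is a 4-cycle packing: a set of pairwise edge-disjoint 4-cycles. -/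
def IsFourCyclePacking {V : Type*} [DecidableEq V] (C : Finset (Finset (Sym2 V))) : Prop :=
  (∀ E ∈ C, IsFourCycle E) ∧ ∀ E ∈ C, ∀ F ∈ C, E ≠ F → Disjoint E F

/-- `C` is `r`-sparse: it contains no `(j+3, j)`-configuration for `2 ≤ j ≤ r`. -/
def RSparse {V : Type*} [DecidableEq V] (r : ℕ) (C : Finset (Finset (Sym2 V))) : Prop :=
  ∀ j, 2 ≤ j → j ≤ r → ∀ D ⊆ C, ¬ IsConfiguration (j + 3) j D

/-- Two 4-cycles form a double-diamond: they are `(a,b,c,d)` and `(a,e,c,f)`,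
sharing the diagonal {a,c}. -/
def IsDoubleDiamond {V : Type*} [DecidableEq V] (E F : Finset (Sym2 V)) : Prop :=
  ∃ a b c d e f : V, ([a, b, c, d, e, f] : List V).Nodup ∧
    E = cycEdges a b c d ∧ F = cycEdges a e c f

/-- `C` is D-avoiding: no two of its 4-cycles form a double-diamond. -/
def DAvoiding {V : Type*} [DecidableEq V] (C : Finset (Finset (Sym2 V))) : Prop :=
  ∀ E ∈ C, ∀ F ∈ C, ¬ IsDoubleDiamond E F

/-- `C` is strictly `r`-sparse: `r`-sparse and D-avoiding. -/
def StrictlyRSparse {V : Type*} [DecidableEq V] (r : ℕ)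
    (C : Finset (Finset (Sym2 V))) : Prop :=
  RSparse r C ∧ DAvoiding C

/-- Configurations `A` and `B` are isomorphic: there is a bijection between their
vertex sets mapping each 4-cycle of `A` to a 4-cycle of `B`. -/
def ConfigIso {V W : Type*} [DecidableEq V] [DecidableEq W]
    (A : Finset (Finset (Sym2 V))) (B : Finset (Finset (Sym2 W))) : Prop :=
  ∃ φ : V → W, Set.BijOn φ ↑(A.sup edgeVerts) ↑(B.sup edgeVerts) ∧
    ∀ E ∈ A, E.image (Sym2.map φ) ∈ B

lemma edgeVerts_cyc {V : Type*} [DecidableEq V] (a b c d : V) :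
    edgeVerts (cycEdges a b c d) = {a, b, c, d} := by
  ext x
  simp [edgeVerts, cycEdges]
  tauto

lemma image_cyc {V W : Type*} [DecidableEq V] [DecidableEq W] (g : V → W) (a b c d : V) :
    (cycEdges a b c d).image (Sym2.map g) = cycEdges (g a) (g b) (g c) (g d) := by
  simp [cycEdges, Finset.image_insert]

/-- The ten 4-cycles on `Fin 6` that are edge-disjoint from `(0,1,2,3)`. -/
def secondCycles : List (Finset (Sym2 (Fin 6))) :=
  [cycEdges 0 4 2 5, cycEdges 0 2 4 5, cycEdges 0 2 5 4,
   cycEdges 1 4 3 5, cycEdges 1 3 4 5, cycEdges 1 3 5 4,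
   cycEdges 0 4 1 5, cycEdges 2 4 3 5, cycEdges 1 4 2 5, cycEdges 0 4 3 5]

lemma mem_secondCycles : ∀ p q r s : Fin 6, ([p, q, r, s] : List (Fin 6)).Nodup →
    Disjoint (cycEdges 0 1 2 3) (cycEdges p q r s) → cycEdges p q r s ∈ secondCycles := by
  intro p q
  fin_cases p <;> fin_cases q <;> decide +kernel

/-- Labelings witnessing the classification. -/
def labelings : List (Fin 6 × Fin 6 × Fin 6 × Fin 6 × Fin 6 × Fin 6) :=
  [(0, 1, 2, 3, 4, 5), (0, 1, 2, 3, 5, 4), (1, 0, 3, 2, 5, 4), (1, 0, 3, 2, 4, 5),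
   (4, 0, 5, 1, 3, 2), (4, 1, 5, 2, 0, 3)]

/-- `{X, Y, Z}` equals `{P, Q, R}` in one of the matchings that are needed below. -/
def Matches {α : Type*} (X Y Z P Q R : α) : Prop :=
  (X = P ∧ Y = Q ∧ Z = R) ∨ (X = P ∧ Y = R ∧ Z = Q) ∨
  (X = R ∧ Y = P ∧ Z = Q) ∨ (X = R ∧ Y = Q ∧ Z = P)

instance {α : Type*} [DecidableEq α] (X Y Z P Q R : α) : Decidable (Matches X Y Z P Q R) :=
  inferInstanceAs (Decidable (_ ∨ _))

lemma Matches.eq {α : Type*} [DecidableEq α] {X Y Z P Q R : α} (h : Matches X Y Z P Q R) :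
    ({X, Y, Z} : Finset α) = {P, Q, R} := by
  rcases h with ⟨rfl, rfl, rfl⟩ | ⟨rfl, rfl, rfl⟩ | ⟨rfl, rfl, rfl⟩ | ⟨rfl, rfl, rfl⟩ <;>
    ext x <;> simp only [Finset.mem_insert, Finset.mem_singleton] <;> tauto

lemma classify_idx : ∀ i j : Fin 10, Disjoint (secondCycles.get i) (secondCycles.get j) →
    ∃ t ∈ labelings,
      ([t.1, t.2.1, t.2.2.1, t.2.2.2.1, t.2.2.2.2.1, t.2.2.2.2.2] : List (Fin 6)).Nodup ∧
      (Matches (cycEdges 0 1 2 3) (secondCycles.get i) (secondCycles.get j) (cycEdges t.1 t.2.1 t.2.2.1 t.2.2.2.1)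
         (cycEdges t.1 t.2.2.2.2.1 t.2.2.1 t.2.2.2.2.2)
         (cycEdges t.2.1 t.2.2.2.2.1 t.2.2.2.2.2 t.2.2.2.1) ∨
       Matches (cycEdges 0 1 2 3) (secondCycles.get i) (secondCycles.get j) (cycEdges t.1 t.2.1 t.2.2.1 t.2.2.2.1)
         (cycEdges t.1 t.2.2.2.2.1 t.2.2.1 t.2.2.2.2.2)
         (cycEdges t.2.1 t.2.2.2.2.1 t.2.2.2.1 t.2.2.2.2.2)) := by
  intro i j
  fin_cases i <;> fin_cases j <;> decide +kernel

lemma classify_fin : ∀ E ∈ secondCycles, ∀ F ∈ secondCycles, Disjoint E F →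
    ∃ t ∈ labelings,
      ([t.1, t.2.1, t.2.2.1, t.2.2.2.1, t.2.2.2.2.1, t.2.2.2.2.2] : List (Fin 6)).Nodup ∧
      (Matches (cycEdges 0 1 2 3) E F (cycEdges t.1 t.2.1 t.2.2.1 t.2.2.2.1)
         (cycEdges t.1 t.2.2.2.2.1 t.2.2.1 t.2.2.2.2.2)
         (cycEdges t.2.1 t.2.2.2.2.1 t.2.2.2.2.2 t.2.2.2.1) ∨
       Matches (cycEdges 0 1 2 3) E F (cycEdges t.1 t.2.1 t.2.2.1 t.2.2.2.1)
         (cycEdges t.1 t.2.2.2.2.1 t.2.2.1 t.2.2.2.2.2)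
         (cycEdges t.2.1 t.2.2.2.2.1 t.2.2.2.1 t.2.2.2.2.2)) := by
  intro E hE F hF
  obtain ⟨i, rfl⟩ := List.mem_iff_get.mp hE
  obtain ⟨j, rfl⟩ := List.mem_iff_get.mp hF
  exact classify_idx i j

lemma disjoint_of_image {α β : Type*} [DecidableEq α] [DecidableEq β] (g : α → β)
    (E F : Finset α) (h : Disjoint (E.image g) (F.image g)) : Disjoint E F := by
  rw [Finset.disjoint_left] at h ⊢
  intro x hx hy
  exact h (Finset.mem_image_of_mem g hx) (Finset.mem_image_of_mem g hy)

lemma finish {V : Type*} [DecidableEq V] {a b c d e f x y : V} {X Y : Finset (Sym2 V)}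
    (hn : ([a, b, c, d, e, f] : List V).Nodup)
    (he : x = a ∨ x = b ∨ x = c ∨ x = d ∨ x = e ∨ x = f)
    (hf : y = a ∨ y = b ∨ y = c ∨ y = d ∨ y = e ∨ y = f)
    (h1 : Y = cycEdges a b c d ∨ Y = cycEdges a e c f ∨ Y = cycEdges b e d f)
    (h3 : X = cycEdges a b c d ∨ X = cycEdges a e c f ∨ X = cycEdges b e d f)
    (hedge : s(x, y) ∈ X) (hke : x ∉ edgeVerts Y) (hkf : y ∉ edgeVerts Y) : False := by
  have hedge' : s(x, y) ∈ cycEdges a b c d ∨ s(x, y) ∈ cycEdges a e c f ∨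
      s(x, y) ∈ cycEdges b e d f := by
    rcases h3 with rfl | rfl | rfl
    · exact Or.inl hedge
    · exact Or.inr (Or.inl hedge)
    · exact Or.inr (Or.inr hedge)
  clear hedge h3
  simp only [List.nodup_cons, List.mem_cons, List.not_mem_nil, or_false, not_or] at hn
  simp only [cycEdges, Finset.mem_insert, Finset.mem_singleton, Sym2.eq_iff] at hedge'
  rcases h1 with rfl | rfl | rfl
  · simp only [edgeVerts_cyc, Finset.mem_insert, Finset.mem_singleton, not_or] at hke hkf
    have hx : x = e ∨ x = f := by simpa only [hke, false_or, or_false] using he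
    have hy : y = e ∨ y = f := by simpa only [hkf, false_or, or_false] using hf
    clear he hf hke hkf
    rcases hx with rfl | rfl <;> rcases hy with rfl | rfl <;> grind
  · simp only [edgeVerts_cyc, Finset.mem_insert, Finset.mem_singleton, not_or] at hke hkf
    have hx : x = b ∨ x = d := by simpa only [hke, false_or, or_false] using he
    have hy : y = b ∨ y = d := by simpa only [hkf, false_or, or_false] using hf
    clear he hf hke hkf
    rcases hx with rfl | rfl <;> rcases hy with rfl | rfl <;> grind
  · simp only [edgeVerts_cyc, Finset.mem_insert, Finset.mem_singleton, not_or] at hke hkf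
    have hx : x = a ∨ x = c := by simpa only [hke, false_or, or_false] using he
    have hy : y = a ∨ y = c := by simpa only [hkf, false_or, or_false] using hf
    clear he hf hke hkf
    rcases hx with rfl | rfl <;> rcases hy with rfl | rfl <;> grind

lemma not_iso {V : Type*} [DecidableEq V] :
    ∀ a b c d e f : V, ([a, b, c, d, e, f] : List V).Nodup →
      ¬ ConfigIso
        ({cycEdges a b c d, cycEdges a e c f, cycEdges b e f d} : Finset (Finset (Sym2 V)))
        ({cycEdges a b c d, cycEdges a e c f, cycEdges b e d f} : Finset (Finset (Sym2 V))) := by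
  rintro a b c d e f hn ⟨φ, hb, hφ⟩
  have h1 := hφ (cycEdges a b c d) (by simp)
  have h3 := hφ (cycEdges b e f d) (by simp)
  simp only [Finset.sup_insert, Finset.sup_singleton, edgeVerts_cyc, Finset.sup_eq_union] at hb
  have heA : e ∈ (({a, b, c, d} ∪ ({a, e, c, f} ∪ {b, e, f, d}) : Finset V) : Set V) := by simp
  have hfA : f ∈ (({a, b, c, d} ∪ ({a, e, c, f} ∪ {b, e, f, d}) : Finset V) : Set V) := by simp
  have hxS : ∀ x ∈ ({a, b, c, d} : Finset V),
      x ∈ (({a, b, c, d} ∪ ({a, e, c, f} ∪ {b, e, f, d}) : Finset V) : Set V) :=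
    fun x hx => Finset.mem_coe.mpr (Finset.mem_union_left _ hx)
  have he := hb.mapsTo heA
  have hf := hb.mapsTo hfA
  have hn0 := hn
  simp only [List.nodup_cons, List.mem_cons, List.not_mem_nil] at hn
  have key : ∀ x ∈ ({a, b, c, d} : Finset V), φ x ≠ φ e ∧ φ x ≠ φ f := by
    intro x hx
    have hxA := hxS x hx
    simp only [Finset.mem_insert, Finset.mem_singleton] at hx
    constructor
    · intro h
      have h' := hb.injOn hxA heA h
      clear hb hφ h1 h3 he hf hxA heA hfA hxS h
      grind
    · intro h
      have h' := hb.injOn hxA hfA h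
      clear hb hφ h1 h3 he hf hxA heA hfA hxS h
      grind
  have hke : φ e ∉ ({φ a, φ b, φ c, φ d} : Finset V) := by
    have := key a (by simp); have := key b (by simp)
    have := key c (by simp); have := key d (by simp)
    simp; grind
  have hkf : φ f ∉ ({φ a, φ b, φ c, φ d} : Finset V) := by
    have := key a (by simp); have := key b (by simp)
    have := key c (by simp); have := key d (by simp)
    simp; grind
  rw [image_cyc] at h1 h3
  have hedge : s(φ e, φ f) ∈ cycEdges (φ b) (φ e) (φ f) (φ d) := by simp [cycEdges]
  generalize cycEdges (φ b) (φ e) (φ f) (φ d) = X at h3 hedge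
  rw [← edgeVerts_cyc] at hke hkf
  generalize cycEdges (φ a) (φ b) (φ c) (φ d) = Y at h1 hke hkf
  simp only [Finset.mem_insert, Finset.mem_singleton] at h1 h3
  simp only [Finset.mem_coe, Finset.mem_union, Finset.mem_insert, Finset.mem_singleton] at he hf
  exact finish hn0 (by clear * - he; tauto) (by clear * - hf; tauto) h1 h3 hedge hke hkf

/-- Every `(6,3)`-configuration is of one of the two forms
`{(a,b,c,d), (a,e,c,f), (b,e,f,d)}` or `{(a,b,c,d), (a,e,c,f), (b,e,d,f)}` on six
distinct vertices, and these two forms are not isomorphic to each other. -/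
theorem six_three_configuration_classification {V : Type*} [DecidableEq V] :
    (∀ A : Finset (Finset (Sym2 V)), IsConfiguration 6 3 A →
      ∃ a b c d e f : V, ([a, b, c, d, e, f] : List V).Nodup ∧
        (A = {cycEdges a b c d, cycEdges a e c f, cycEdges b e f d} ∨
         A = {cycEdges a b c d, cycEdges a e c f, cycEdges b e d f})) ∧
    (∀ a b c d e f : V, ([a, b, c, d, e, f] : List V).Nodup →
      ¬ ConfigIso
        ({cycEdges a b c d, cycEdges a e c f, cycEdges b e f d} : Finset (Finset (Sym2 V)))
        ({cycEdges a b c d, cycEdges a e c f, cycEdges b e d f} : Finset (Finset (Sym2 V)))) := by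
  constructor
  · rintro A ⟨hc, h4, hd, hv⟩
    obtain ⟨E, F, G, hEF, hEG, hFG, rfl⟩ := Finset.card_eq_three.mp hc
    have dEF := hd E (by simp) F (by simp) hEF
    have dEG := hd E (by simp) G (by simp) hEG
    have dFG := hd F (by simp) G (by simp) hFG
    obtain ⟨a, b, c, d, hn, rfl⟩ := h4 E (by simp)
    obtain ⟨p, q, r, s, hn2, rfl⟩ := h4 F (by simp)
    obtain ⟨t, u, v, w, hn3, rfl⟩ := h4 G (by simp)
    simp only [Finset.sup_insert, Finset.sup_singleton, edgeVerts_cyc, Finset.sup_eq_union] at hv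
    set S : Finset V := ({a, b, c, d} : Finset V) ∪ ({p, q, r, s} ∪ {t, u, v, w}) with hS
    have h4c : ({a, b, c, d} : Finset V).card = 4 := by
      have := List.toFinset_card_of_nodup hn
      simpa using this
    have h2 : (S \ {a, b, c, d}).card = 2 := by
      rw [Finset.card_sdiff_of_subset (by rw [hS]; exact Finset.subset_union_left), hv, h4c]
    obtain ⟨e, f, hef, hSd⟩ := Finset.card_eq_two.mp h2
    have hnd : ([a, b, c, d, e, f] : List V).Nodup := by
      have he : e ∈ S \ {a, b, c, d} := by rw [hSd]; simp
      have hf : f ∈ S \ {a, b, c, d} := by rw [hSd]; simp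
      simp only [Finset.mem_sdiff, Finset.mem_insert, Finset.mem_singleton] at he hf
      simp only [List.nodup_cons, List.mem_cons, List.not_mem_nil] at hn ⊢
      grind
    let g : Fin 6 → V := fun i => [a, b, c, d, e, f].get i
    have hg : Function.Injective g := List.nodup_iff_injective_get.mp hnd
    have hsurj : ∀ x ∈ S, ∃ i, g i = x := by
      intro x hx
      by_cases hx' : x ∈ ({a, b, c, d} : Finset V)
      · simp only [Finset.mem_insert, Finset.mem_singleton] at hx'
        rcases hx' with rfl | rfl | rfl | rfl
        exacts [⟨0, rfl⟩, ⟨1, rfl⟩, ⟨2, rfl⟩, ⟨3, rfl⟩]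
      · have : x ∈ S \ {a, b, c, d} := Finset.mem_sdiff.mpr ⟨hx, hx'⟩
        rw [hSd] at this
        simp only [Finset.mem_insert, Finset.mem_singleton] at this
        rcases this with rfl | rfl
        exacts [⟨4, rfl⟩, ⟨5, rfl⟩]
    have hg0 : cycEdges a b c d = (cycEdges (0 : Fin 6) 1 2 3).image (Sym2.map g) := by
      rw [image_cyc]; rfl
    obtain ⟨p, rfl⟩ := hsurj p (by simp [hS])
    obtain ⟨q, rfl⟩ := hsurj q (by simp [hS])
    obtain ⟨r, rfl⟩ := hsurj r (by simp [hS])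
    obtain ⟨s, rfl⟩ := hsurj s (by simp [hS])
    obtain ⟨t, rfl⟩ := hsurj t (by simp [hS])
    obtain ⟨u, rfl⟩ := hsurj u (by simp [hS])
    obtain ⟨v, rfl⟩ := hsurj v (by simp [hS])
    obtain ⟨w, rfl⟩ := hsurj w (by simp [hS])
    have hn2' : ([p, q, r, s] : List (Fin 6)).Nodup := List.Nodup.of_map g hn2
    have hn3' : ([t, u, v, w] : List (Fin 6)).Nodup := List.Nodup.of_map g hn3
    rw [hg0, ← image_cyc] at dEF dEG
    rw [← image_cyc, ← image_cyc] at dFG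
    have m1 := mem_secondCycles p q r s hn2' (disjoint_of_image _ _ _ dEF)
    have m2 := mem_secondCycles t u v w hn3' (disjoint_of_image _ _ _ dEG)
    obtain ⟨⟨i, j, k, l, m, n⟩, -, hnod, hfin⟩ :=
      classify_fin _ m1 _ m2 (disjoint_of_image _ _ _ dFG)
    refine ⟨g i, g j, g k, g l, g m, g n, List.Nodup.map hg hnod, ?_⟩
    rw [hg0]
    refine hfin.imp ?_ ?_
    all_goals
      intro h
      have h' := congrArg (Finset.image (Finset.image (Sym2.map g))) h.eq
      simpa only [Finset.image_insert, Finset.image_singleton, image_cyc] using h'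
  · exact not_iso
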